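/- Let k and ℓ be natural numbers with ℓ ≤ k, and let R be a commutative ring. In the monoid algebra MonoidAlgebra R (Equiv.Perm (Fin k)), the product of the element ∑_{τ} τ, where τ ranges over all (k,ℓ)-shuffles of Fin k, with the element ∑_{ρ} ρ, where ρ ranges over all (k,ℓ)-block permutations of Fin k, equals the element ∑_{σ} σ, where σ ranges over all permutations of Fin k. -/

import Mathlib

/-- A (k,ℓ)-shuffle: a permutation of `Fin k` strictly monotone on the first `ℓ`
indices and strictly monotone on the remaining indices. -/
def IsShuffle (k ℓ : ℕ) (τ : Equiv.Perm (Fin k)) : Prop :=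
  StrictMonoOn τ {i : Fin k | (i : ℕ) < ℓ} ∧ StrictMonoOn τ {i : Fin k | ℓ ≤ (i : ℕ)}

/-- A (k,ℓ)-unshuffle: the inverse of a (k,ℓ)-shuffle. -/
def IsUnshuffle (k ℓ : ℕ) (τ : Equiv.Perm (Fin k)) : Prop :=
  IsShuffle k ℓ τ⁻¹

/-- A (k,ℓ)-block permutation: a permutation of `Fin k` mapping the set of the
first `ℓ` indices onto itself. -/
def IsBlockPerm (k ℓ : ℕ) (ρ : Equiv.Perm (Fin k)) : Prop :=
  ⇑ρ '' {i : Fin k | (i : ℕ) < ℓ} = {i : Fin k | (i : ℕ) < ℓ}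

theorem block_iff (k ℓ : ℕ) (ρ : Equiv.Perm (Fin k)) :
    IsBlockPerm k ℓ ρ ↔ ∀ i, ((ρ i : ℕ) < ℓ ↔ (i : ℕ) < ℓ) := by
  unfold IsBlockPerm
  constructor
  · intro h i
    have := Set.ext_iff.1 h (ρ i)
    simpa using this.symm
  · intro h
    ext j
    have := h (ρ.symm j)
    simp only [Equiv.apply_symm_apply] at this
    simp only [Set.mem_image, Set.mem_setOf_eq]
    constructor
    · rintro ⟨i, hi, rfl⟩
      exact (h i).2 hi
    · intro hj
      exact ⟨ρ.symm j, this.1 hj, by simp⟩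

/-- The sorting key. -/
def shKey (k ℓ : ℕ) (σ : Equiv.Perm (Fin k)) (i : Fin k) : Bool ×ₗ Fin k :=
  toLex (decide (ℓ ≤ (i : ℕ)), σ i)

theorem shKey_mono (k ℓ : ℕ) (τ : Equiv.Perm (Fin k)) (h : IsShuffle k ℓ τ) :
    Monotone (shKey k ℓ τ) := by
  intro i j hij
  rcases hij.eq_or_lt with rfl | hij
  · exact le_rfl
  have hij' : (i : ℕ) < j := hij
  unfold shKey
  rw [Prod.Lex.toLex_le_toLex]
  by_cases hi : ℓ ≤ (i : ℕ)
  · have hj : ℓ ≤ (j : ℕ) := by omega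
    right
    exact ⟨by simp [hi, hj], (h.2 hi hj hij).le⟩
  · by_cases hj : ℓ ≤ (j : ℕ)
    · left; simp [hi, hj]
    · right
      exact ⟨by simp [hi, hj], (h.1 (not_le.1 hi) (not_le.1 hj) hij).le⟩

theorem shuffle_unique (k ℓ : ℕ) (τ π : Equiv.Perm (Fin k)) (h : IsShuffle k ℓ τ)
    (h' : IsShuffle k ℓ (τ * π)) (hb : ∀ i, ((π i : ℕ) < ℓ ↔ (i : ℕ) < ℓ)) : π = 1 := by
  have e : shKey k ℓ (τ * π) = shKey k ℓ τ ∘ π := by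
    funext i
    have : ℓ ≤ (π i : ℕ) ↔ ℓ ≤ (i : ℕ) := by have := hb i; omega
    simp [shKey, this]
  have m := shKey_mono k ℓ _ h'
  rw [e] at m
  have m0 : Monotone (shKey k ℓ τ ∘ (1 : Equiv.Perm (Fin k))) := shKey_mono k ℓ _ h
  have u := Tuple.unique_monotone m m0
  ext1 i
  have := congrArg (fun x => (ofLex x).2) (congrFun u i)
  simpa [shKey] using this

theorem shuffle_exists (k ℓ : ℕ) (σ : Equiv.Perm (Fin k)) :
    ∃ π : Equiv.Perm (Fin k), IsShuffle k ℓ (σ * π) ∧ ∀ i, ((π i : ℕ) < ℓ ↔ (i : ℕ) < ℓ) := by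
  let π := Tuple.sort (shKey k ℓ σ)
  have m : Monotone (shKey k ℓ σ ∘ π) := Tuple.monotone_sort _
  let f : Fin k → Bool := fun i => decide (ℓ ≤ (i : ℕ))
  have m1 : Monotone (f ∘ π) := by
    intro i j hij
    have := m hij
    simp only [shKey, Function.comp, Prod.Lex.toLex_le_toLex] at this
    rcases this with h | h
    · exact h.le
    · exact h.1.le
  have m0 : Monotone (f ∘ (1 : Equiv.Perm (Fin k))) := by
    intro i j hij
    have hij' : (i : ℕ) ≤ j := hij
    simp only [f, Function.comp, Equiv.Perm.coe_one, id]
    by_cases hi : ℓ ≤ (i : ℕ)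
    · have hj : ℓ ≤ (j : ℕ) := by omega
      simp [hi, hj]
    · simp [hi]
  have u := Tuple.unique_monotone m1 m0
  have hb : ∀ i, (ℓ ≤ (π i : ℕ) ↔ ℓ ≤ (i : ℕ)) := by
    intro i
    simpa [f] using congrFun u i
  have key : ∀ i j : Fin k, (ℓ ≤ (i : ℕ) ↔ ℓ ≤ (j : ℕ)) → i < j → (σ * π) i < (σ * π) j := by
    intro i j hd hij
    have := m hij.le
    simp only [shKey, Function.comp, Prod.Lex.toLex_le_toLex, hb, hd, lt_irrefl, false_or,
      true_and] at this
    exact lt_of_le_of_ne this (fun e => hij.ne ((σ * π).injective e))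
  refine ⟨π, ⟨?_, ?_⟩, fun i => by have := hb i; omega⟩
  · intro i hi j hj hij
    simp only [Set.mem_setOf_eq] at hi hj
    exact key i j (by omega) hij
  · intro i hi j hj hij
    simp only [Set.mem_setOf_eq] at hi hj
    exact key i j (by omega) hij

open scoped Classical in
/-- In the monoid algebra, (sum of shuffles) * (sum of block permutations)
equals the sum of all permutations. -/
theorem shuffleSum_mul_blockSum (k ℓ : ℕ) (h : ℓ ≤ k) (R : Type*) [CommRing R] :
    ((∑ τ ∈ Finset.univ.filter (fun τ => IsShuffle k ℓ τ),
        MonoidAlgebra.of R (Equiv.Perm (Fin k)) τ) *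
      (∑ ρ ∈ Finset.univ.filter (fun ρ => IsBlockPerm k ℓ ρ),
        MonoidAlgebra.of R (Equiv.Perm (Fin k)) ρ)) =
    ∑ σ : Equiv.Perm (Fin k), MonoidAlgebra.of R (Equiv.Perm (Fin k)) σ := by
  rw [Finset.sum_mul_sum, ← Finset.sum_product']
  refine Finset.sum_bij (fun p _ => p.1 * p.2) (fun _ _ => Finset.mem_univ _) ?_ ?_ ?_
  · rintro ⟨τ, ρ⟩ h1 ⟨τ', ρ'⟩ h2 e
    simp only [Finset.mem_product, Finset.mem_filter, Finset.mem_univ, true_and, block_iff]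
      at h1 h2 e
    have e' : τ' = τ * (ρ * ρ'⁻¹) := by rw [← mul_assoc, e]; simp
    have hs := h2.1
    rw [e'] at hs
    have := shuffle_unique k ℓ τ (ρ * ρ'⁻¹) h1.1 hs (by
      intro i
      have a := h1.2 (ρ'⁻¹ i)
      have b := h2.2 (ρ'⁻¹ i)
      rw [← Equiv.Perm.mul_apply, mul_inv_cancel, Equiv.Perm.one_apply] at b
      rw [Equiv.Perm.mul_apply, a, b])
    rw [this, mul_one] at e'
    subst e'
    simpa using e
  · intro σ _
    obtain ⟨π, h1, h2⟩ := shuffle_exists k ℓ σ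
    refine ⟨(σ * π, π⁻¹), ?_, by simp⟩
    simp only [Finset.mem_product, Finset.mem_filter, Finset.mem_univ, true_and, block_iff]
    refine ⟨h1, fun i => ?_⟩
    have b := h2 (π⁻¹ i)
    rw [← Equiv.Perm.mul_apply, mul_inv_cancel, Equiv.Perm.one_apply] at b
    exact b.symm
  · intro p _
    rw [map_mul]
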